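/- arXiv:1606.06208 — 3 statements merged into one kernel-verified Lean document; each statement's English description precedes it below -/
import Mathlib

section
/- Let R ∈ SO(3) and let A be a symmetric real 3×3 matrix such that Ā = (tr(A)I − A)/2 is positive definite. Set ξ = λ_min(Ā)/λ_max(Ā). Then ξ² |R|_I² (1 − |R|_I²) ≤ ‖ψ(AR)‖²/(2 λ_max(Ā))² ≤ |R|_I² (1 − ξ² |R|_I²). -/
open Matrix Filter

noncomputable section

attribute [local instance] Matrix.normedAddCommGroup Matrix.normedSpace

/-- 3×3 real matrices. -/
abbrev M3 := Matrix (Fin 3) (Fin 3) ℝ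
/-- vectors in ℝ³. -/
abbrev V3 := Fin 3 → ℝ

/-- `R ∈ SO(3)`: `RᵀR = I` and `det R = 1`. -/
def SO3 (R : M3) : Prop := Rᵀ * R = 1 ∧ R.det = 1

/-- The skew-symmetric matrix `[x]ₓ` with `[x]ₓ y = x × y`. -/
def skew (x : V3) : M3 :=
  !![0, -x 2, x 1; x 2, 0, -x 0; -x 1, x 0, 0]

/-- Inverse of `skew` on skew-symmetric matrices. -/
def vex (M : M3) : V3 := ![M 2 1, M 0 2, M 1 0]

/-- Anti-symmetric projection `P_a(M) = (M - Mᵀ)/2`. -/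
def Pa (M : M3) : M3 := (2:ℝ)⁻¹ • (M - Mᵀ)

/-- `ψ(M) = vex(P_a(M))`. -/
def psi (M : M3) : V3 := vex (Pa M)

/-- Squared normalized Euclidean distance `|R|_I² = tr(I - R)/4`. -/
def normI2 (R : M3) : ℝ := (1 - R).trace / 4

/-- Rodrigues vector `Z(R) = ψ(R)/(2(1 - |R|_I²))`. -/
def Zof (R : M3) : V3 := (2 * (1 - normI2 R))⁻¹ • psi R

/-- Cayley map `R_r(z) = (I + [z]ₓ)(I - [z]ₓ)⁻¹`. -/
def Rr (z : V3) : M3 := (1 + skew z) * (1 - skew z)⁻¹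

/-- Angle-axis map `R_a(θ,u) = I + sin θ [u]ₓ + (1 - cos θ)[u]ₓ²`. -/
def Ra (θ : ℝ) (u : V3) : M3 :=
  1 + Real.sin θ • skew u + (1 - Real.cos θ) • (skew u * skew u)

/-- `g(z) = (1/2)(I + [z]ₓ + z zᵀ)`. -/
def gmat (z : V3) : M3 := (2:ℝ)⁻¹ • ((1 : M3) + skew z + vecMulVec z z)

/-- `Ā = (tr(A) I - A)/2`. -/
def Abar (A : M3) : M3 := (2:ℝ)⁻¹ • (A.trace • (1 : M3) - A)

/-- smallest eigenvalue of a positive-definite symmetric real matrix. -/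
def lmin {B : M3} (hB : B.PosDef) : ℝ := ⨅ i, hB.1.eigenvalues i

/-- largest eigenvalue of a positive-definite symmetric real matrix. -/
def lmax {B : M3} (hB : B.PosDef) : ℝ := ⨆ i, hB.1.eigenvalues i

/-- A symmetric array whose 2×2 minors through a positive diagonal entry vanish has rank one. -/
theorem exists_mul_eq_of_minors {ι : Type*} (M : ι → ι → ℝ) (p : ι) (hp : 0 < M p p)
    (hM : ∀ j k, M p j * M p k = M p p * M j k) : ∃ q : ι → ℝ, ∀ j k, q j * q k = M j k := by
  refine ⟨fun j => M p j / √(M p p), fun j k => ?_⟩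
  rw [div_mul_div_comm, Real.mul_self_sqrt hp.le, hM, mul_div_cancel_left₀ _ hp.ne']

/-- Four times the products of pairs of components of a unit quaternion representing `R`. -/
def quatProd (R : M3) : Fin 4 → Fin 4 → ℝ :=
  ![![1 + R 0 0 + R 1 1 + R 2 2, R 2 1 - R 1 2, R 0 2 - R 2 0, R 1 0 - R 0 1],
    ![R 2 1 - R 1 2, 1 + R 0 0 - R 1 1 - R 2 2, R 0 1 + R 1 0, R 0 2 + R 2 0],
    ![R 0 2 - R 2 0, R 0 1 + R 1 0, 1 - R 0 0 + R 1 1 - R 2 2, R 1 2 + R 2 1],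
    ![R 1 0 - R 0 1, R 0 2 + R 2 0, R 1 2 + R 2 1, 1 - R 0 0 - R 1 1 + R 2 2]]

theorem SO3.adjugate_eq {R : M3} (hR : SO3 R) : R.adjugate = Rᵀ := by
  have h : R.adjugate * R = 1 := by rw [adjugate_mul, hR.2, one_smul]
  have h' : R * Rᵀ = 1 := mul_eq_one_comm.mp hR.1
  calc R.adjugate = R.adjugate * (R * Rᵀ) := by rw [h', mul_one]
    _ = Rᵀ := by rw [← mul_assoc, h, one_mul]

theorem SO3.quatProd_minor {R : M3} (hR : SO3 R) (p j k : Fin 4) :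
    quatProd R p j * quatProd R p k = quatProd R p p * quatProd R j k := by
  have hrow : R * Rᵀ = 1 := mul_eq_one_comm.mp hR.1
  have hcol := hR.1
  have hadj := hR.adjugate_eq
  rw [← Matrix.ext_iff] at hrow hcol hadj
  simp only [adjugate_fin_three, Fin.forall_fin_succ, mul_apply, transpose_apply,
    Fin.sum_univ_three, one_apply, of_apply, cons_val', cons_val_zero] at hrow hcol hadj
  simp at hrow hcol hadj
  fin_cases p <;> fin_cases j <;> fin_cases k <;> simp [quatProd] <;> grind

/-- Every rotation is the image of a unit quaternion. -/
theorem SO3.exists_quaternion {R : M3} (hR : SO3 R) :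
    ∃ q : Fin 4 → ℝ, ∀ j k, q j * q k = quatProd R j k := by
  obtain ⟨p, hp⟩ : ∃ p, 0 < quatProd R p p := by
    by_contra! h
    have := h 0; have := h 1; have := h 2; have := h 3
    simp [quatProd] at *
    linarith
  exact exists_mul_eq_of_minors _ p hp (hR.quatProd_minor p)

theorem psi_mul_eq {A R : M3} (hA : A.IsSymm) {q : Fin 4 → ℝ}
    (hq : ∀ j k, q j * q k = quatProd R j k) :
    (2 : ℝ) • psi (A * R) = q 0 • (Abar A *ᵥ ![q 1, q 2, q 3]) -
      ![q 1, q 2, q 3] ⨯₃ (Abar A *ᵥ ![q 1, q 2, q 3]) := by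
  have h₁ := hA.apply 0 1
  have h₂ := hA.apply 0 2
  have h₃ := hA.apply 1 2
  simp [quatProd, Fin.forall_fin_succ] at hq
  ext i
  fin_cases i <;>
    simp [psi, vex, Pa, Abar, mul_apply, mulVec, dotProduct, Fin.sum_univ_three, trace,
      crossProduct, one_apply, h₁, h₂, h₃] <;> grind

/-- The quadratic forms of `1`, `B` and `B²` in an orthonormal eigenbasis of `B`. -/
theorem exists_spectral_coords {n : Type*} [Fintype n] [DecidableEq n] {B : Matrix n n ℝ}
    (hB : B.IsHermitian) (v : n → ℝ) :
    ∃ c : n → ℝ, v ⬝ᵥ v = ∑ i, c i ^ 2 ∧ v ⬝ᵥ (B *ᵥ v) = ∑ i, hB.eigenvalues i * c i ^ 2 ∧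
      (B *ᵥ v) ⬝ᵥ (B *ᵥ v) = ∑ i, hB.eigenvalues i ^ 2 * c i ^ 2 := by
  set U := (hB.eigenvectorUnitary : Matrix n n ℝ)
  set D : Matrix n n ℝ := diagonal hB.eigenvalues with hD
  have hUU : Uᵀ * U = 1 := Unitary.coe_star_mul_self hB.eigenvectorUnitary
  have hUU' : U * Uᵀ = 1 := mul_eq_one_comm.mp hUU
  have hspec : B = U * D * Uᵀ := by
    simpa [Unitary.conjStarAlgAut_apply, Function.comp_def, star_eq_conjTranspose]
      using hB.spectral_theorem
  have hdot (x y : n → ℝ) : (U *ᵥ x) ⬝ᵥ (U *ᵥ y) = x ⬝ᵥ y := by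
    rw [dotProduct_mulVec, vecMul_mulVec, hUU, vecMul_one]
  obtain ⟨c, rfl⟩ : ∃ c, v = U *ᵥ c := ⟨Uᵀ *ᵥ v, by rw [mulVec_mulVec, hUU', one_mulVec]⟩
  have hBv : B *ᵥ (U *ᵥ c) = U *ᵥ (D *ᵥ c) := by
    rw [mulVec_mulVec, mulVec_mulVec, hspec, mul_assoc, hUU, mul_one]
  refine ⟨c, ?_, ?_, ?_⟩
  · rw [hdot]; simp [dotProduct, sq]
  · rw [hBv, hdot, hD]
    exact Finset.sum_congr rfl fun i _ => by rw [mulVec_diagonal]; ring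
  · rw [hBv, hdot, hD]
    exact Finset.sum_congr rfl fun i _ => by rw [mulVec_diagonal]; ring

theorem lmin_le_eigenvalues {B : M3} (hB : B.PosDef) (i : Fin 3) :
    lmin hB ≤ hB.1.eigenvalues i :=
  ciInf_le (Set.finite_range _).bddBelow i

theorem eigenvalues_le_lmax {B : M3} (hB : B.PosDef) (i : Fin 3) :
    hB.1.eigenvalues i ≤ lmax hB :=
  le_ciSup (Set.finite_range _).bddAbove i

theorem lmin_pos {B : M3} (hB : B.PosDef) : 0 < lmin hB := by
  obtain ⟨i, hi⟩ := exists_eq_ciInf_of_finite (f := hB.1.eigenvalues)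
  exact (hB.eigenvalues_pos i).trans_eq hi

theorem lmax_pos {B : M3} (hB : B.PosDef) : 0 < lmax hB :=
  (hB.eigenvalues_pos 0).trans_le (eigenvalues_le_lmax hB 0)

theorem lmin_mul_le_dotProduct_mulVec {B : M3} (hB : B.PosDef) (v : V3) :
    lmin hB * (v ⬝ᵥ v) ≤ v ⬝ᵥ (B *ᵥ v) := by
  obtain ⟨c, h₁, h₂, -⟩ := exists_spectral_coords hB.1 v
  rw [h₁, h₂, Finset.mul_sum]
  gcongr with i
  exact lmin_le_eigenvalues hB i

theorem lmin_sq_mul_le_mulVec_dotProduct_mulVec {B : M3} (hB : B.PosDef) (v : V3) :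
    lmin hB ^ 2 * (v ⬝ᵥ v) ≤ (B *ᵥ v) ⬝ᵥ (B *ᵥ v) := by
  obtain ⟨c, h₁, -, h₂⟩ := exists_spectral_coords hB.1 v
  rw [h₁, h₂, Finset.mul_sum]
  gcongr with i
  · exact (lmin_pos hB).le
  · exact lmin_le_eigenvalues hB i

theorem mulVec_dotProduct_mulVec_le_lmax_sq_mul {B : M3} (hB : B.PosDef) (v : V3) :
    (B *ᵥ v) ⬝ᵥ (B *ᵥ v) ≤ lmax hB ^ 2 * (v ⬝ᵥ v) := by
  obtain ⟨c, h₁, -, h₂⟩ := exists_spectral_coords hB.1 v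
  rw [h₁, h₂, Finset.mul_sum]
  gcongr with i
  · exact (hB.eigenvalues_pos i).le
  · exact eigenvalues_le_lmax hB i

theorem dotProduct_sub_cross_self (a : ℝ) (v w : V3) :
    (a • w - v ⨯₃ w) ⬝ᵥ (a • w - v ⨯₃ w) =
      (a * a + v ⬝ᵥ v) * (w ⬝ᵥ w) - (v ⬝ᵥ w) ^ 2 := by
  simp [crossProduct, dotProduct, Fin.sum_univ_three]
  ring

/-- `ψ(AR)` and `|R|_I²` in terms of the vector part `v` of a quaternion of norm `2` for `R`. -/
theorem SO3.exists_psi_dotProduct_eq {A R : M3} (hA : A.IsSymm) (hR : SO3 R) :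
    ∃ v : V3, normI2 R = v ⬝ᵥ v / 4 ∧ v ⬝ᵥ v ≤ 4 ∧
      4 * (psi (A * R) ⬝ᵥ psi (A * R)) =
        4 * ((Abar A *ᵥ v) ⬝ᵥ (Abar A *ᵥ v)) - (v ⬝ᵥ (Abar A *ᵥ v)) ^ 2 := by
  obtain ⟨q, hq⟩ := hR.exists_quaternion
  have hpsi := psi_mul_eq hA hq
  set v : V3 := ![q 1, q 2, q 3] with hv
  have hvv : v ⬝ᵥ v = 3 - R.trace := by
    have h₁ := hq 1 1
    have h₂ := hq 2 2
    have h₃ := hq 3 3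
    simp [quatProd] at h₁ h₂ h₃
    simp [hv, dotProduct, trace, Fin.sum_univ_three]
    linarith
  have hqq : q 0 * q 0 + v ⬝ᵥ v = 4 := by
    rw [hvv, hq]
    simp [quatProd, trace, Fin.sum_univ_three]
    ring
  refine ⟨v, ?_, ?_, ?_⟩
  · simp [normI2, hvv]
  · linarith [mul_self_nonneg (q 0)]
  · have h := dotProduct_sub_cross_self (q 0) v (Abar A *ᵥ v)
    rw [← hpsi, hqq, smul_dotProduct, dotProduct_smul, smul_eq_mul, smul_eq_mul] at h
    linarith

theorem sq_dotProduct_le (v w : V3) : (v ⬝ᵥ w) ^ 2 ≤ (v ⬝ᵥ v) * (w ⬝ᵥ w) := by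
  simpa [dotProduct, sq] using Finset.sum_mul_sq_le_sq_mul_sq Finset.univ v w

/-- with `ξ = λ_min(Ā)/λ_max(Ā)`,
`ξ² |R|_I² (1 − |R|_I²) ≤ ‖ψ(AR)‖²/(2 λ_max(Ā))² ≤ |R|_I² (1 − ξ² |R|_I²)`. -/
theorem stmt2 (A : M3) (hA : A.IsSymm) (hPD : (Abar A).PosDef)
    (R : M3) (hR : SO3 R) (ξ : ℝ) (hξ : ξ = lmin hPD / lmax hPD) :
    ξ ^ 2 * normI2 R * (1 - normI2 R) ≤
        (psi (A * R) ⬝ᵥ psi (A * R)) / (2 * lmax hPD) ^ 2 ∧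
    (psi (A * R) ⬝ᵥ psi (A * R)) / (2 * lmax hPD) ^ 2 ≤
        normI2 R * (1 - ξ ^ 2 * normI2 R) := by
  obtain ⟨v, hn, hv4, hpsi⟩ := hR.exists_psi_dotProduct_eq hA
  have hl := lmin_pos hPD
  have hL := lmax_pos hPD
  have hs := lmin_mul_le_dotProduct_mulVec hPD v
  have hlow := lmin_sq_mul_le_mulVec_dotProduct_mulVec hPD v
  have hupp := mulVec_dotProduct_mulVec_le_lmax_sq_mul hPD v
  have hcs := sq_dotProduct_le v (Abar A *ᵥ v)
  have hv0 : 0 ≤ v ⬝ᵥ v := by simpa using dotProduct_star_self_nonneg v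
  have hs2 := pow_le_pow_left₀ (mul_nonneg hl.le hv0) hs 2
  have hmul := mul_le_mul_of_nonneg_right hlow (sub_nonneg.mpr hv4)
  rw [hξ, hn]
  generalize lmin hPD = l at *
  generalize lmax hPD = L at *
  generalize v ⬝ᵥ v = t at *
  constructor
  · rw [le_div_iff₀ (by positivity)]
    calc (l / L) ^ 2 * (t / 4) * (1 - t / 4) * (2 * L) ^ 2 = l ^ 2 * t * (4 - t) / 4 := by
          field_simp
          ring
      _ ≤ _ := by linarith
  · rw [div_le_iff₀ (by positivity)]
    calc _ ≤ (4 * L ^ 2 * t - (l * t) ^ 2) / 4 := by linarith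
      _ = t / 4 * (1 - (l / L) ^ 2 * (t / 4)) * (2 * L) ^ 2 := by
          field_simp
          ring

end
end

section
/- Let R ∈ SO(3) with |R|_I < 1. Then R + I is invertible, the matrix (R − I)(R + I)⁻¹ is skew-symmetric with vex((R − I)(R + I)⁻¹) = ψ(R)/(2(1 − |R|_I²)) =: Z(R), ‖Z(R)‖² = |R|_I²/(1 − |R|_I²), and R_r(Z(R)) = R, where R_r(z) = (I + [z]_×)(I − [z]_×)⁻¹. -/
open Matrix Filter

noncomputable section

attribute [local instance] Matrix.normedAddCommGroup Matrix.normedSpace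

theorem vex_skew (x : V3) : vex (skew x) = x := by
  ext i
  fin_cases i <;> simp [vex, skew]

theorem skew_transpose (x : V3) : (skew x)ᵀ = -skew x := by
  ext i j
  fin_cases i <;> fin_cases j <;> simp [skew]

theorem skew_smul (c : ℝ) (x : V3) : skew (c • x) = c • skew x := by
  ext i j
  fin_cases i <;> fin_cases j <;> simp [skew]

theorem skew_psi (M : M3) : skew (psi M) = Pa M := by
  ext i j
  fin_cases i <;> fin_cases j <;> simp [skew, psi, vex, Pa] <;> ring

/-- Twice the squared norm of a vector is minus the trace of the square of its skew matrix. -/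
theorem trace_skew_mul_skew (x : V3) : (skew x * skew x).trace = -2 * (x ⬝ᵥ x) := by
  simp [skew, Matrix.trace_fin_three, dotProduct, Fin.sum_univ_three]
  ring

/-- The Cayley–Hamilton theorem for 3×3 matrices, divided by the matrix. -/
theorem adjugate_eq_sq_sub (M : M3) :
    M.adjugate = M * M - M.trace • (1 : M3) * M + M.adjugate.trace • (1 : M3) := by
  rw [Matrix.adjugate_fin_three]
  ext i j
  fin_cases i <;> fin_cases j <;>
    simp [Matrix.trace_fin_three, Matrix.mul_apply, Fin.sum_univ_three] <;> ring

theorem det_add_one (M : M3) :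
    (M + 1).det = M.det + M.adjugate.trace + M.trace + 1 := by
  rw [Matrix.adjugate_fin_three]
  simp [Matrix.trace_fin_three, Matrix.det_fin_three]
  ring

namespace SO3

variable {R : M3}

theorem adjugate_eq_s5 (hR : SO3 R) : R.adjugate = Rᵀ := by
  calc R.adjugate = Rᵀ * R * R.adjugate := by rw [hR.1, one_mul]
    _ = Rᵀ := by rw [mul_assoc, Matrix.mul_adjugate, hR.2, one_smul, mul_one]

theorem transpose_eq (hR : SO3 R) :
    Rᵀ = R * R - R.trace • R + R.trace • (1 : M3) := by
  have h := adjugate_eq_sq_sub R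
  rwa [hR.adjugate_eq_s5, Matrix.trace_transpose, smul_one_mul] at h

theorem det_add_one (hR : SO3 R) : (R + 1).det = 2 * (1 + R.trace) := by
  rw [_root_.det_add_one, hR.adjugate_eq_s5, hR.2, Matrix.trace_transpose]
  ring

theorem trace_mul_self (hR : SO3 R) : (R * R).trace = R.trace ^ 2 - 2 * R.trace := by
  have h := congrArg Matrix.trace hR.transpose_eq
  simp only [Matrix.trace_transpose, Matrix.trace_add, Matrix.trace_sub, Matrix.trace_smul,
    Matrix.trace_one, Fintype.card_fin, smul_eq_mul] at h
  push_cast at h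
  linarith

theorem psi_dotProduct_psi (hR : SO3 R) :
    psi R ⬝ᵥ psi R = (3 - R.trace) * (1 + R.trace) / 4 := by
  have h := trace_skew_mul_skew (psi R)
  have hT : (Rᵀ * Rᵀ).trace = (R * R).trace := by
    rw [← Matrix.transpose_mul, Matrix.trace_transpose]
  simp only [skew_psi, Pa, smul_mul_smul_comm, sub_mul, mul_sub, hR.1,
    mul_eq_one_comm.mp hR.1, Matrix.trace_smul, Matrix.trace_sub, hT, hR.trace_mul_self,
    Matrix.trace_one, Fintype.card_fin, smul_eq_mul] at h
  push_cast at h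
  linarith

theorem skew_psi_mul_add_one (hR : SO3 R) :
    skew (psi R) * (R + 1) = ((1 + R.trace) / 2) • (R - 1) := by
  have h : (R - Rᵀ) * (R + 1) = (1 + R.trace) • (R - 1) := by
    rw [sub_mul, mul_add, mul_add, hR.1, mul_one, mul_one, hR.transpose_eq]
    module
  rw [skew_psi, Pa, smul_mul_assoc, h, smul_smul]
  congr 1
  ring

end SO3

theorem normI2_eq (R : M3) : normI2 R = (3 - R.trace) / 4 := by
  simp [normI2, Matrix.trace_sub]

/-- for `R ∈ SO(3)` with `|R|_I < 1`: `R + I` is invertible,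
`(R−I)(R+I)⁻¹` is skew-symmetric with `vex` equal to `Z(R)`,
`‖Z(R)‖² = |R|_I²/(1−|R|_I²)`, and `R_r(Z(R)) = R`. -/
theorem stmt5 (R : M3) (hR : SO3 R) (h1 : normI2 R < 1) :
    IsUnit (R + 1) ∧
    ((R - 1) * (R + 1)⁻¹)ᵀ = -((R - 1) * (R + 1)⁻¹) ∧
    vex ((R - 1) * (R + 1)⁻¹) = Zof R ∧
    Zof R ⬝ᵥ Zof R = normI2 R / (1 - normI2 R) ∧
    Rr (Zof R) = R := by
  have ht : 0 < 1 + R.trace := by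
    rw [normI2_eq] at h1
    linarith
  have hc : 2 * (1 - normI2 R) = (1 + R.trace) / 2 := by
    rw [normI2_eq]
    ring
  have hdet : IsUnit (R + 1).det := by
    rw [hR.det_add_one]
    exact (mul_pos two_pos ht).ne'.isUnit
  have hmul : skew (Zof R) * (R + 1) = R - 1 := by
    rw [Zof, skew_smul, smul_mul_assoc, hR.skew_psi_mul_add_one, hc,
      inv_smul_smul₀ (by positivity)]
  have hZ : (R - 1) * (R + 1)⁻¹ = skew (Zof R) := by
    rw [← hmul, Matrix.mul_nonsing_inv_cancel_right _ _ hdet]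
  have hinv : (1 - skew (Zof R))⁻¹ = (2 : ℝ)⁻¹ • (R + 1) := by
    apply Matrix.inv_eq_right_inv
    rw [mul_smul_comm, sub_mul, one_mul, hmul]
    module
  refine ⟨(Matrix.isUnit_iff_isUnit_det _).2 hdet, ?_, ?_, ?_, ?_⟩
  · rw [hZ, skew_transpose]
  · rw [hZ, vex_skew]
  · rw [Zof, smul_dotProduct, dotProduct_smul, hR.psi_dotProduct_psi, hc, normI2_eq,
      show 1 - (3 - R.trace) / 4 = (1 + R.trace) / 4 by ring, smul_eq_mul, smul_eq_mul]
    field_simp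
    ring
  · rw [Rr, hinv, mul_smul_comm, add_mul, one_mul, hmul]
    module

end
end

section
/- Let R : ℝ → ℝ^{3×3} be differentiable on an open interval J, with R(t) ∈ SO(3), |R(t)|_I < 1, and R'(t) = R(t)[ξ(t)]_× for all t ∈ J, where ξ : J → ℝ³. Then the map t ↦ Z(R(t)) is differentiable on J with derivative (d/dt) Z(R(t)) = (1/2)(I + [Z(R(t))]_× + Z(R(t)) Z(R(t))ᵀ) ξ(t). -/
open Matrix Filter

noncomputable section

attribute [local instance] Matrix.normedAddCommGroup Matrix.normedSpace

/-- The adjugate of a rotation matrix is its transpose. -/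
lemma SO3.adjugate_eq_transpose {R : M3} (h : SO3 R) : R.adjugate = Rᵀ := by
  have h' := congrArg (Rᵀ * ·) (mul_adjugate R)
  simpa [← Matrix.mul_assoc, h.1, h.2] using h'

/-- Twice the axial vector of the skew-symmetric part, in terms of the entries. -/
lemma two_smul_psi (R : M3) :
    (2 : ℝ) • psi R = ![R 2 1 - R 1 2, R 0 2 - R 2 0, R 1 0 - R 0 1] := by
  ext i
  fin_cases i <;> simp [psi, Pa, vex]

/-- The Rodrigues vector as the quotient of `2 ψ(R)` by `1 + tr R`. -/
lemma Zof_eq (R : M3) : Zof R = (1 + R.trace)⁻¹ • ((2 : ℝ) • psi R) := by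
  have h : 2 * (1 - normI2 R) = (1 + R.trace) / 2 := by
    simp only [normI2, trace_sub, trace_one, Fintype.card_fin]
    push_cast
    ring
  rw [Zof, h, smul_smul, inv_div, div_eq_inv_mul]

/-- On `SO(3)`, the outer square of `2 ψ(R)` is `(1 + tr R)(R + Rᵀ + (1 - tr R) I)`. -/
lemma SO3.vecMulVec_two_smul_psi {R : M3} (h : SO3 R) :
    vecMulVec ((2 : ℝ) • psi R) ((2 : ℝ) • psi R) =
      (1 + R.trace) • (R + Rᵀ + (1 - R.trace) • (1 : M3)) := by
  have hc := h.1
  have hr := mul_eq_one_comm.mp h.1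
  have ha := h.adjugate_eq_transpose
  rw [two_smul_psi]
  rw [adjugate_fin_three] at ha
  simp only [← Matrix.ext_iff, Fin.forall_fin_succ, Matrix.mul_apply, Fin.sum_univ_three,
    transpose_apply, Matrix.one_apply] at hc hr ha
  simp at hc hr ha
  ext i j
  fin_cases i <;> fin_cases j <;> simp [vecMulVec_apply, trace_fin_three] <;> grind

/-- The derivative of `1 + tr R` along `R' = R[x]ₓ`. -/
lemma trace_mul_skew (R : M3) (x : V3) :
    (R * skew x).trace = -(((2 : ℝ) • psi R) ⬝ᵥ x) := by
  rw [two_smul_psi]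
  simp [trace_fin_three, Matrix.mul_apply, Fin.sum_univ_three, skew, dotProduct]
  ring

/-- The derivative of `2 ψ(R)` along `R' = R[x]ₓ`. -/
lemma two_smul_psi_mul_skew (R : M3) (x : V3) :
    (2 : ℝ) • psi (R * skew x) = (R.trace • (1 : M3) - Rᵀ) *ᵥ x := by
  rw [two_smul_psi]
  ext i
  fin_cases i <;>
    simp [trace_fin_three, Matrix.mul_apply, Fin.sum_univ_three, skew, mulVec, dotProduct] <;>
    ring

/-- The axial vector of the skew-symmetric part of a matrix curve is differentiated entrywise. -/
lemma HasDerivAt.psi {R : ℝ → M3} {R' : M3} {t : ℝ} (h : HasDerivAt R R' t) :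
    HasDerivAt (fun s => psi (R s)) (_root_.psi R') t := by
  have e : ∀ i j, HasDerivAt (fun s => R s i j) (R' i j) t := fun i j =>
    hasDerivAt_pi.1 (hasDerivAt_pi.1 h i) j
  rw [hasDerivAt_pi]
  intro i
  fin_cases i
  · simpa [_root_.psi, vex, Pa] using ((e 2 1).sub (e 1 2)).const_mul (2 : ℝ)⁻¹
  · simpa [_root_.psi, vex, Pa] using ((e 0 2).sub (e 2 0)).const_mul (2 : ℝ)⁻¹
  · simpa [_root_.psi, vex, Pa] using ((e 1 0).sub (e 0 1)).const_mul (2 : ℝ)⁻¹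

/-- The trace of a matrix curve is differentiated entrywise. -/
lemma HasDerivAt.trace_fin_three {R : ℝ → M3} {R' : M3} {t : ℝ} (h : HasDerivAt R R' t) :
    HasDerivAt (fun s => (R s).trace) R'.trace t := by
  have e : ∀ i j, HasDerivAt (fun s => R s i j) (R' i j) t := fun i j =>
    hasDerivAt_pi.1 (hasDerivAt_pi.1 h i) j
  simp only [Matrix.trace_fin_three]
  exact ((e 0 0).add (e 1 1)).add (e 2 2)

/-- The value of the quotient-rule derivative of the Rodrigues vector along `R' = R[x]ₓ`. -/
lemma SO3.rodrigues_quotient_rule {R : M3} (h : SO3 R) (hT : 1 + R.trace ≠ 0) (x : V3) :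
    (1 + R.trace)⁻¹ • ((2 : ℝ) • psi (R * skew x)) +
        (-(R * skew x).trace / (1 + R.trace) ^ 2) • ((2 : ℝ) • psi R) =
      (2 : ℝ)⁻¹ • ((1 + skew (Zof R) + vecMulVec (Zof R) (Zof R)) *ᵥ x) := by
  have hv := h.vecMulVec_two_smul_psi
  rw [two_smul_psi_mul_skew, trace_mul_skew, Zof_eq]
  have hs : skew ((2 : ℝ) • psi R) = R - Rᵀ := by
    rw [two_smul_psi]
    ext i j
    fin_cases i <;> fin_cases j <;> simp [skew]
  have hsm : ∀ (c : ℝ) (v : V3), skew (c • v) = c • skew v := by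
    intro c v
    ext i j
    fin_cases i <;> fin_cases j <;> simp [skew]
  have hd : (((2 : ℝ) • psi R) ⬝ᵥ x) • ((2 : ℝ) • psi R) =
      vecMulVec ((2 : ℝ) • psi R) ((2 : ℝ) • psi R) *ᵥ x := by
    rw [vecMulVec_mulVec, op_smul_eq_smul]
  rw [neg_neg, div_eq_inv_mul, mul_smul, hd, hsm, hs, smul_vecMulVec _ ((2 : ℝ) • psi R),
    vecMulVec_smul (1 + R.trace)⁻¹, hv, ← smul_mulVec, ← smul_mulVec, ← smul_mulVec, ← add_mulVec]
  congr 1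
  ext i j
  simp only [Matrix.add_apply, Matrix.sub_apply, Matrix.smul_apply, smul_eq_mul]
  field_simp
  ring

/-- derivative of the Rodrigues vector along `R' = R[ξ]ₓ`. -/
theorem stmt6 (a b : ℝ) (R : ℝ → M3) (ξ : ℝ → V3)
    (hSO : ∀ t ∈ Set.Ioo a b, SO3 (R t))
    (h1 : ∀ t ∈ Set.Ioo a b, normI2 (R t) < 1)
    (hR' : ∀ t ∈ Set.Ioo a b, HasDerivAt R (R t * skew (ξ t)) t) :
    ∀ t ∈ Set.Ioo a b,
      HasDerivAt (fun s => Zof (R s))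
        ((2:ℝ)⁻¹ •
          ((1 + skew (Zof (R t)) + vecMulVec (Zof (R t)) (Zof (R t))) *ᵥ ξ t)) t := by
  intro t ht
  have hT : 1 + (R t).trace ≠ 0 := by
    have h := h1 t ht
    simp only [normI2, trace_sub, trace_one, Fintype.card_fin] at h
    push_cast at h
    linarith
  have hp := (hR' t ht).psi.const_smul (2 : ℝ)
  have hi := ((hR' t ht).trace_fin_three.const_add 1).inv hT
  simp only [Zof_eq (R _)]
  rw [← Zof_eq, ← (hSO t ht).rodrigues_quotient_rule hT]
  exact hi.smul hp

end
end
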